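/- arXiv:2410.14533 — 2 statements merged into one kernel-verified Lean document; each statement's English description precedes it below -/
import Mathlib

section
/- Let (M, dist) be a connected metric space, ε > 0, and suppose M is covered by n open balls of radius ε with centers in M. Then for every m ≥ 1 and every collection of points x₁, …, x_m ∈ M there exists a permutation σ of {1,…,m} such that Σ_{k=1}^{m-1} dist(x_{σ(k)}, x_{σ(k+1)}) ≤ (4n + 2m)·ε. -/
open scoped BigOperators

/-- The length of the path through the points `x (σ 1), …, x (σ n)` determined by the
permutation `σ` of `Fin n`: the sum of distances between consecutive points. -/
noncomputable def pathLength {M : Type*} [MetricSpace M] {n : ℕ}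
    (x : Fin n → M) (σ : Equiv.Perm (Fin n)) : ℝ :=
  ∑ i : Fin n, if h : (i : ℕ) + 1 < n then dist (x (σ i)) (x (σ ⟨(i : ℕ) + 1, h⟩)) else 0

/-- Length of a path given as a list. -/
noncomputable def plen {M : Type*} [MetricSpace M] : List M → ℝ
  | [] => 0
  | [_] => 0
  | a :: b :: l => dist a b + plen (b :: l)

theorem plen_insert {M : Type*} [MetricSpace M] (a b : M) (t : List M) : ∀ s : List M,
    plen (s ++ a :: b :: t) ≤ plen (s ++ a :: t) + 2 * dist a b
  | [] => by
    cases t with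
    | nil =>
      have := dist_nonneg (x := a) (y := b)
      simp only [List.nil_append, plen]
      linarith
    | cons c t =>
      simp only [List.nil_append, plen]
      have := dist_triangle b a c
      rw [dist_comm b a] at this
      linarith
  | [c] => by
    have := plen_insert a b t []
    simp only [List.nil_append, List.cons_append, plen] at this ⊢
    linarith
  | c :: d :: s => by
    have := plen_insert a b t (d :: s)
    simp only [List.cons_append, plen] at this ⊢
    linarith

theorem plen_nonneg {M : Type*} [MetricSpace M] : ∀ s : List M, 0 ≤ plen s
  | [] => by simp [plen]
  | [c] => by simp [plen]
  | c :: d :: s => by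
    have := plen_nonneg (d :: s)
    have := dist_nonneg (x := c) (y := d)
    simp only [plen]
    linarith

theorem plen_cons_le {M : Type*} [MetricSpace M] (a b : M) : ∀ s : List M,
    plen (a :: s) ≤ plen (a :: b :: s)
  | [] => by simp [plen]
  | c :: s => by
    have := dist_triangle a b c
    simp only [plen]
    linarith

theorem plen_le_cons {M : Type*} [MetricSpace M] (a : M) : ∀ s : List M,
    plen s ≤ plen (a :: s)
  | [] => by simp [plen]
  | c :: s => by simp [plen]

theorem plen_sublist_aux {M : Type*} [MetricSpace M] {s t : List M} (h : s.Sublist t) :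
    plen s ≤ plen t ∧ ∀ a, plen (a :: s) ≤ plen (a :: t) := by
  induction h with
  | slnil => simp
  | @cons s t b h ih =>
    exact ⟨ih.1.trans (plen_le_cons _ _), fun a => (ih.2 a).trans (plen_cons_le _ _ _)⟩
  | @cons_cons s t b h ih =>
    refine ⟨ih.2 b, fun a => ?_⟩
    have := ih.2 b
    simp only [plen]
    linarith

theorem insert_near {M ι : Type*} [MetricSpace M] (g : ι → M) (l : List ι) (a b : ι)
    (ha : a ∈ l) : ∃ l' : List ι, l'.Perm (b :: l) ∧
      plen (l'.map g) ≤ plen (l.map g) + 2 * dist (g a) (g b) := by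
  obtain ⟨s, t, rfl⟩ := List.append_of_mem ha
  refine ⟨s ++ a :: b :: t, ?_, ?_⟩
  · have h1 : (s ++ a :: b :: t) = (s ++ [a]) ++ b :: t := by simp
    have h2 : (s ++ a :: t) = (s ++ [a]) ++ t := by simp
    rw [h1, h2]
    exact List.perm_middle
  · simpa using plen_insert (g a) (g b) (t.map g) (s.map g)

theorem plen_ofFn {M : Type*} [MetricSpace M] : ∀ (m : ℕ) (y : Fin m → M),
    (∑ i : Fin m, if h : (i : ℕ) + 1 < m then dist (y i) (y ⟨(i : ℕ) + 1, h⟩) else 0)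
      = plen (List.ofFn y)
  | 0, y => by simp [plen]
  | 1, y => by simp [plen]
  | m + 2, y => by
    have ih := plen_ofFn (m + 1) (fun i => y i.succ)
    rw [Fin.sum_univ_succ, List.ofFn_succ, List.ofFn_succ, plen]
    rw [List.ofFn_succ] at ih
    rw [← ih]
    congr 1
    simp

theorem centers {M : Type*} [MetricSpace M] [ConnectedSpace M]
    {n : ℕ} (ε : ℝ) (hε : 0 < ε) (z : Fin n → M)
    (hcover : ∀ x : M, ∃ i : Fin n, dist x (z i) < ε) :
    ∀ k : ℕ, k + 1 ≤ n → ∃ l : List (Fin n), l.Nodup ∧ l.length = k + 1 ∧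
      plen (l.map z) ≤ 4 * k * ε := by
  intro k
  induction k with
  | zero => intro h; exact ⟨[⟨0, h⟩], by simp, by simp, by simp [plen]⟩
  | succ k ih =>
    intro h
    obtain ⟨l, hl, hlen, hp⟩ := ih (by omega)
    have hb : ∃ b, b ∉ l := by
      by_contra! hc
      have : (Finset.univ : Finset (Fin n)) ⊆ l.toFinset := fun i _ => by simpa using hc i
      have := Finset.card_le_card this
      rw [List.toFinset_card_of_nodup hl] at this
      simp at this
      omega
    have hne : ∃ a, a ∈ l := by
      apply List.exists_mem_of_length_pos; omega
    obtain ⟨b0, hb0⟩ := hb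
    obtain ⟨a0, ha0⟩ := hne
    have hU : IsOpen (⋃ a ∈ {a | a ∈ l}, Metric.ball (z a) ε) :=
      isOpen_biUnion fun _ _ => Metric.isOpen_ball
    have hV : IsOpen (⋃ a ∈ {a | a ∉ l}, Metric.ball (z a) ε) :=
      isOpen_biUnion fun _ _ => Metric.isOpen_ball
    obtain ⟨p, hpU, hpV⟩ := nonempty_inter hU hV (by
        ext p
        obtain ⟨i, hi⟩ := hcover p
        by_cases hil : i ∈ l
        · simp only [Set.mem_union, Set.mem_iUnion, Set.mem_univ, iff_true]
          exact Or.inl ⟨i, hil, hi⟩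
        · simp only [Set.mem_union, Set.mem_iUnion, Set.mem_univ, iff_true]
          exact Or.inr ⟨i, hil, hi⟩)
      ⟨z a0, Set.mem_biUnion (x := a0) ha0 (Metric.mem_ball_self hε)⟩
      ⟨z b0, Set.mem_biUnion (x := b0) hb0 (Metric.mem_ball_self hε)⟩
    simp only [Set.mem_iUnion, Metric.mem_ball, Set.mem_ofPred_eq, exists_prop] at hpU hpV
    obtain ⟨a, ha, hpa⟩ := hpU
    obtain ⟨b, hb, hpb⟩ := hpV
    obtain ⟨l', hl', hp'⟩ := insert_near z l a b ha
    refine ⟨l', ?_, ?_, ?_⟩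
    · rw [hl'.nodup_iff]; exact List.nodup_cons.2 ⟨hb, hl⟩
    · rw [hl'.length_eq]; simp [hlen]
    · have := dist_triangle_left (z a) (z b) p
      push_cast
      linarith

theorem points {M : Type*} [MetricSpace M]
    {n m : ℕ} (ε : ℝ) (z : Fin n → M) (x : Fin m → M)
    (hcover : ∀ x : M, ∃ i : Fin n, dist x (z i) < ε) (l : List (Fin n)) (hl : ∀ i, i ∈ l) :
    ∀ s : List (Fin m), ∃ t : List (Fin n ⊕ Fin m), t.Perm (s.map Sum.inr ++ l.map Sum.inl) ∧
      plen (t.map (Sum.elim z x)) ≤ plen (l.map z) + 2 * s.length * ε := by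
  intro s
  induction s with
  | nil => exact ⟨l.map Sum.inl, by simp, by simp⟩
  | cons j s ih =>
    obtain ⟨t, ht, hp⟩ := ih
    obtain ⟨i, hi⟩ := hcover (x j)
    obtain ⟨t', ht', hp'⟩ := insert_near (Sum.elim z x) t (Sum.inl i) (Sum.inr j)
      (ht.mem_iff.2 (by simp [hl i]))
    refine ⟨t', ht'.trans (by simpa using ht), ?_⟩
    simp only [Sum.elim_inl, Sum.elim_inr] at hp'
    rw [dist_comm] at hp'
    simp only [List.length_cons]
    push_cast
    linarith

theorem sub_right {M α β : Type*} (z : α → M) (x : β → M) (t : List (α ⊕ β)) :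
    ((t.filterMap Sum.getRight?).map x).Sublist (t.map (Sum.elim z x)) := by
  induction t with
  | nil => simp
  | cons a t ih =>
    cases a with
    | inl a => exact ih.cons _
    | inr a => exact ih.cons_cons _

/-- Quantitative core of Theorem 1: if a connected metric space is covered by `n` open
`ε`-balls, then any `m ≥ 1` points admit a path through them of length at most
`(4 * n + 2 * m) * ε`. -/
theorem path_through_points_of_cover {M : Type*} [MetricSpace M] [ConnectedSpace M]
    {n : ℕ} (ε : ℝ) (hε : 0 < ε) (z : Fin n → M)
    (hcover : ∀ x : M, ∃ i : Fin n, dist x (z i) < ε) :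
    ∀ m : ℕ, 1 ≤ m → ∀ x : Fin m → M, ∃ σ : Equiv.Perm (Fin m),
      pathLength x σ ≤ (4 * n + 2 * m) * ε := by
  intro m hm x
  obtain ⟨i0, -⟩ := hcover (x ⟨0, hm⟩)
  have hn : 0 < n := i0.pos
  obtain ⟨k, rfl⟩ : ∃ k, n = k + 1 := ⟨n - 1, by omega⟩
  obtain ⟨l, hl, hlen, hp⟩ := centers ε hε z hcover k le_rfl
  have hall : ∀ i, i ∈ l := by
    have : l.toFinset = Finset.univ := by
      apply Finset.eq_univ_of_card
      rw [List.toFinset_card_of_nodup hl, hlen]; simp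
    intro i
    rw [← List.mem_toFinset, this]; simp
  obtain ⟨t, ht, hpt⟩ := points ε z x hcover l hall (List.finRange m)
  have hr : (t.filterMap Sum.getRight?).Perm (List.finRange m) := by
    refine (ht.filterMap _).trans ?_
    have h1 : ((Sum.getRight? : Fin (k+1) ⊕ Fin m → _) ∘ Sum.inr : Fin m → Option (Fin m)) = some := rfl
    have h2 : (Sum.getRight? ∘ Sum.inl : Fin (k+1) → Option (Fin m)) = fun _ => none := rfl
    simp [List.filterMap_append, List.filterMap_map, h1, h2]
  have hsub := (plen_sublist_aux (sub_right z x t)).1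
  generalize t.filterMap Sum.getRight? = r at hr hsub
  have hrn : r.Nodup := hr.nodup_iff.2 (List.nodup_finRange m)
  have hrl : r.length = m := by simpa using hr.length_eq
  have hrm : ∀ j, j ∈ r := fun j => hr.mem_iff.2 (List.mem_finRange j)
  refine ⟨(finCongr hrl.symm).trans (hrn.getEquivOfForallMemList r hrm), ?_⟩
  unfold pathLength
  rw [plen_ofFn m (fun i => x (((finCongr hrl.symm).trans (hrn.getEquivOfForallMemList r hrm)) i))]
  have he : List.ofFn (fun i => x (((finCongr hrl.symm).trans
      (hrn.getEquivOfForallMemList r hrm)) i)) = r.map x := by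
    apply List.ext_getElem
    · simp [hrl]
    · intro i h1 h2
      simp
  rw [he]
  simp only [List.length_finRange] at hpt
  push_cast
  linarith
end

section
/- For every integer d ≥ 2 there exists a constant K > 0 (depending only on d) such that for every n ≥ 1 and every collection of points x₁, …, xₙ in the unit cube [0,1]^d ⊂ ℝ^d (with the Euclidean metric) there exists a permutation σ of {1,…,n} with Σ_{i=1}^{n-1} ‖x_{σ(i)} − x_{σ(i+1)}‖₂ ≤ K · n^{1 - 1/d}. -/
open scoped BigOperators

noncomputable def listLen {M : Type*} [MetricSpace M] : List M → ℝ
  | [] => 0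
  | [_] => 0
  | a :: b :: l => dist a b + listLen (b :: l)

theorem listLen_insert {M : Type*} [MetricSpace M] (p q : M) (l₂ : List M) (l₁ : List M) :
    listLen (l₁ ++ q :: p :: l₂) ≤ listLen (l₁ ++ q :: l₂) + 2 * dist p q := by
  induction l₁ with
  | nil =>
    have h0 : 0 ≤ dist p q := dist_nonneg
    cases l₂ with
    | nil => simp [listLen, dist_comm q p]; linarith
    | cons r l₂ =>
      simp only [List.nil_append, listLen]
      have := dist_triangle p q r
      rw [dist_comm q p]
      linarith
  | cons a l₁ ih =>
    cases l₁ with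
    | nil => simp only [List.nil_append, List.cons_append, listLen] at ih ⊢; linarith
    | cons b l₁ => simp only [List.cons_append, listLen] at ih ⊢; linarith

theorem sum_eq_listLen {M : Type*} [MetricSpace M] : ∀ (n : ℕ) (y : Fin n → M),
    (∑ i : Fin n, if h : (i : ℕ) + 1 < n then dist (y i) (y ⟨(i : ℕ) + 1, h⟩) else 0)
      = listLen (List.ofFn y)
  | 0, y => by simp [listLen]
  | 1, y => by simp [listLen]
  | n + 2, y => by
    have ih := sum_eq_listLen (n + 1) (fun i => y i.succ)
    rw [Fin.sum_univ_succ, List.ofFn_succ]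
    rw [List.ofFn_succ] at ih ⊢
    rw [listLen, ← ih]
    congr 1
    · apply Finset.sum_congr rfl
      intro i _
      by_cases h : (i : ℕ) + 1 < n + 1
      · have h' : ((i.succ : Fin (n + 2)) : ℕ) + 1 < n + 2 := by simp; omega
        rw [dif_pos h, dif_pos h']
        rfl
      · have h' : ¬ ((i.succ : Fin (n + 2)) : ℕ) + 1 < n + 2 := by simp; omega
        rw [dif_neg h, dif_neg h']

theorem exists_close (d : ℕ) (hd : 2 ≤ d) {ι : Type*} (s : Finset ι) (hs : 2 ≤ s.card)
    (x : ι → EuclideanSpace ℝ (Fin d))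
    (hx : ∀ i k, x i k ∈ Set.Icc (0 : ℝ) 1) :
    ∃ p ∈ s, ∃ q ∈ s, p ≠ q ∧
      dist (x p) (x q) ≤ 2 * d * (s.card : ℝ) ^ (-(1 / (d : ℝ))) := by
  have hd0 : (0 : ℝ) < d := by positivity
  set n := s.card with hn
  have hn2 : (2 : ℝ) ≤ n := by exact_mod_cast hs
  set r : ℝ := (n : ℝ) ^ (1 / (d : ℝ)) with hr
  have hr1 : 1 < r := Real.one_lt_rpow (by linarith) (by positivity)
  have hrd : r ^ d = n := by
    rw [hr, ← Real.rpow_natCast, ← Real.rpow_mul (by positivity)]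
    field_simp
    simp
  obtain ⟨m, hm⟩ : ∃ m : ℕ, ⌈r⌉₊ = m + 1 :=
    Nat.exists_eq_succ_of_ne_zero (Nat.ceil_pos.2 (by linarith)).ne'
  have hm1 : r ≤ m + 1 := by
    have := Nat.le_ceil r
    rw [hm] at this; exact_mod_cast this
  have hm2 : (m : ℝ) < r := Nat.lt_ceil.1 (by omega)
  have hmpos : 1 ≤ m := by
    have : (0 : ℝ) < m := by linarith
    exact_mod_cast this
  have hmR : (1 : ℝ) ≤ m := by exact_mod_cast hmpos
  have hcard : m ^ d < n := by
    have : (m : ℝ) ^ d < r ^ d := pow_lt_pow_left₀ hm2 (by positivity) (by omega)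
    rw [hrd] at this
    exact_mod_cast this
  have hceil : ∀ i k, ⌈(m : ℝ) * x i k⌉₊ ≤ m := by
    intro i k
    apply Nat.ceil_le.2
    have := (hx i k).2
    nlinarith
  let f : ι → (Fin d → Fin m) := fun i k => ⟨⌈(m : ℝ) * x i k⌉₊ - 1, by have := hceil i k; omega⟩
  obtain ⟨p, hp, q, hq, hpq, hf⟩ := Finset.exists_ne_map_eq_of_card_lt_of_maps_to
    (s := s) (t := Finset.univ) (f := f) (by simpa using hcard) (fun _ _ => by simp)
  refine ⟨p, hp, q, hq, hpq, ?_⟩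
  have hb : ∀ i k, ((f i k : ℕ) : ℝ) ≤ m * x i k ∧ m * x i k ≤ (f i k : ℕ) + 1 := by
    intro i k
    have h0 : 0 ≤ (m : ℝ) * x i k := mul_nonneg (by positivity) (hx i k).1
    have h1 := Nat.le_ceil ((m : ℝ) * x i k)
    have h2 := Nat.ceil_lt_add_one h0
    show ((⌈(m : ℝ) * x i k⌉₊ - 1 : ℕ) : ℝ) ≤ _ ∧ _ ≤ ((⌈(m : ℝ) * x i k⌉₊ - 1 : ℕ) : ℝ) + 1
    rcases Nat.eq_zero_or_pos ⌈(m : ℝ) * x i k⌉₊ with h | h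
    · rw [h] at h1 ⊢
      simp at h1 ⊢
      constructor <;> linarith
    · rw [Nat.cast_sub h]
      push_cast
      constructor <;> linarith
  have hk : ∀ k, dist (x p k) (x q k) ≤ 1 / m := by
    intro k
    have h1 := hb p k
    have h2 := hb q k
    rw [hf] at h1
    rw [Real.dist_eq, le_div_iff₀ (by linarith), ← abs_of_pos (by linarith : (0 : ℝ) < m), ← abs_mul, abs_le]
    constructor <;> linarith [h1.1, h1.2, h2.1, h2.2]
  have hdist : dist (x p) (x q) ≤ d * (1 / m) := by
    rw [EuclideanSpace.dist_eq]
    apply Real.sqrt_le_iff.2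
    refine ⟨by positivity, ?_⟩
    calc ∑ k, dist (x p k) (x q k) ^ 2 ≤ ∑ k : Fin d, (1 / (m : ℝ)) ^ 2 :=
          Finset.sum_le_sum fun k _ => pow_le_pow_left₀ dist_nonneg (hk k) 2
      _ = d * (1 / (m : ℝ)) ^ 2 := by simp
      _ ≤ (d * (1 / (m : ℝ))) ^ 2 := by
          rw [mul_pow]
          have : (2 : ℝ) ≤ d := by exact_mod_cast hd
          apply mul_le_mul_of_nonneg_right _ (by positivity)
          nlinarith
  refine hdist.trans ?_
  rw [Real.rpow_neg (by positivity), ← hr, mul_comm (2 : ℝ), mul_assoc]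
  apply mul_le_mul_of_nonneg_left _ hd0.le
  rw [← div_eq_mul_inv, div_le_div_iff₀ (by linarith) (by linarith)]
  linarith

theorem rpow_step (d : ℕ) (hd : 2 ≤ d) (n : ℕ) (hn : 1 ≤ n) :
    (n : ℝ) ^ (1 - 1 / (d : ℝ)) + (1 / 2) * ((n + 1 : ℕ) : ℝ) ^ (-(1 / (d : ℝ)))
      ≤ ((n + 1 : ℕ) : ℝ) ^ (1 - 1 / (d : ℝ)) := by
  have hd2 : (2 : ℝ) ≤ d := by exact_mod_cast hd
  have hdi : 1 / (d : ℝ) ≤ 1 / 2 := one_div_le_one_div_of_le (by norm_num) hd2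
  have hdi0 : 0 ≤ 1 / (d : ℝ) := by positivity
  set t := 1 / (d : ℝ)
  set N : ℝ := ((n + 1 : ℕ) : ℝ) with hN
  have hNpos : 0 < N := by positivity
  have hN1 : 1 ≤ N := by rw [hN]; push_cast; linarith [(Nat.cast_nonneg n : (0 : ℝ) ≤ n)]
  have hnN : (n : ℝ) = N * (1 + -(1 / N)) := by
    field_simp
    rw [hN]; push_cast; ring
  have hinv : 1 / N ≤ 1 := by rw [div_le_one hNpos]; exact hN1
  have hB := rpow_one_add_le_one_add_mul_self (s := -(1 / N)) (by linarith) (p := 1 - t)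
    (by linarith) (by linarith)
  have e : N ^ (1 - t) = N * N ^ (-t) := by
    rw [sub_eq_add_neg, Real.rpow_add hNpos, Real.rpow_one]
  have hP : 0 < N ^ (-t) := Real.rpow_pos_of_pos hNpos _
  rw [hnN, Real.mul_rpow hNpos.le (by linarith)]
  have h1 : N ^ (1 - t) * (1 + -(1 / N)) ^ (1 - t) ≤ N ^ (1 - t) * (1 + (1 - t) * -(1 / N)) :=
    mul_le_mul_of_nonneg_left hB (Real.rpow_nonneg hNpos.le _)
  have h2 : N ^ (1 - t) * (1 + (1 - t) * -(1 / N)) = N ^ (1 - t) - (1 - t) * N ^ (-t) := by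
    rw [e]; field_simp; ring
  nlinarith

theorem exists_list (d : ℕ) (hd : 2 ≤ d) {ι : Type*} [DecidableEq ι]
    (x : ι → EuclideanSpace ℝ (Fin d))
    (hx : ∀ i k, x i k ∈ Set.Icc (0 : ℝ) 1) :
    ∀ (n : ℕ) (s : Finset ι), s.card = n + 1 → ∃ l : List ι, l.Nodup ∧ (∀ i, i ∈ l ↔ i ∈ s) ∧
      listLen (l.map x) ≤ 8 * d * ((n + 1 : ℕ) : ℝ) ^ (1 - 1 / (d : ℝ)) := by
  intro n
  induction n with
  | zero =>
    intro s hs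
    obtain ⟨a, rfl⟩ := Finset.card_eq_one.1 hs
    refine ⟨[a], by simp, by simp, ?_⟩
    simp [listLen]
  | succ n ih =>
    intro s hs
    obtain ⟨p, hp, q, hq, hpq, hdist⟩ := exists_close d hd s (by omega) x hx
    obtain ⟨l, hl, hmem, hlen⟩ := ih (s.erase p) (by rw [Finset.card_erase_of_mem hp]; omega)
    have hql : q ∈ l := (hmem q).2 (Finset.mem_erase.2 ⟨hpq.symm, hq⟩)
    have hpl : p ∉ l := fun h => by simpa using (hmem p).1 h
    obtain ⟨l₁, l₂, rfl⟩ := List.append_of_mem hql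
    have hperm : (l₁ ++ q :: p :: l₂).Perm (p :: (l₁ ++ q :: l₂)) := by
      have := List.perm_middle (a := p) (l₁ := l₁ ++ [q]) (l₂ := l₂)
      simpa using this
    refine ⟨l₁ ++ q :: p :: l₂, ?_, ?_, ?_⟩
    · rw [hperm.nodup_iff]
      exact List.nodup_cons.2 ⟨hpl, hl⟩
    · intro i
      rw [hperm.mem_iff, List.mem_cons, hmem, Finset.mem_erase]
      by_cases h : i = p
      · simp [h, hp]
      · simp [h]
    · have h1 := listLen_insert (x p) (x q) (l₂.map x) (l₁.map x)
      simp only [List.map_append, List.map_cons] at hlen ⊢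
      have h2 := rpow_step d hd (n + 1) (by omega)
      rw [hs] at hdist
      have hd0 : (0 : ℝ) < d := by positivity
      have h3 := mul_le_mul_of_nonneg_left h2 (by positivity : (0 : ℝ) ≤ 8 * d)
      linarith

/-- Classical shortest-path-through-`n`-points bound in the unit cube `[0,1]^d ⊆ ℝ^d`
(with the Euclidean metric): for every `d ≥ 2` there is a constant `K > 0` such that any
`n ≥ 1` points of the cube admit a path through them of length at most `K * n ^ (1 - 1/d)`. -/
theorem path_through_unit_cube (d : ℕ) (hd : 2 ≤ d) :
    ∃ K > 0, ∀ n : ℕ, 1 ≤ n → ∀ x : Fin n → EuclideanSpace ℝ (Fin d),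
      (∀ (i : Fin n) (k : Fin d), x i k ∈ Set.Icc (0 : ℝ) 1) →
      ∃ σ : Equiv.Perm (Fin n),
        pathLength x σ ≤ K * (n : ℝ) ^ (1 - 1 / (d : ℝ)) := by
  refine ⟨8 * d, by positivity, ?_⟩
  intro n hn x hx
  obtain ⟨m, rfl⟩ : ∃ m, n = m + 1 := ⟨n - 1, by omega⟩
  obtain ⟨l, hl, hmem, hlen⟩ := exists_list d hd x hx m Finset.univ (by simp)
  have hmem' : ∀ i, i ∈ l := fun i => (hmem i).2 (Finset.mem_univ i)
  have hlength : m + 1 = l.length := by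
    have := Fintype.card_congr (List.Nodup.getEquivOfForallMemList l hl hmem')
    simpa using this.symm
  let σ : Equiv.Perm (Fin (m + 1)) :=
    (finCongr hlength).trans (List.Nodup.getEquivOfForallMemList l hl hmem')
  refine ⟨σ, ?_⟩
  have h1 : pathLength x σ = listLen (List.ofFn (fun i => x (σ i))) :=
    sum_eq_listLen (m + 1) (fun i => x (σ i))
  have h2 : List.ofFn (fun i => x (σ i)) = l.map x := by
    apply List.ext_getElem
    · simp [hlength]
    · intro i h1 h2
      rw [List.getElem_ofFn, List.getElem_map]
      rfl
  rw [h1, h2]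
  exact hlen
end
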